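/- (Composition computes relational composition on patterns) Let r₁ = (p₁ ↦ p₂) and r₂ = (p₃ ↦ p₄) be functional rewrite rules whose composition r₁ ∘ r₂ exists with result (l ↦ s). Then for all patterns p and q: there exists a substitution σ with σ[l] = p and σ[s] = q if and only if there exists a pattern m and substitutions σ₁, σ₂ with σ₁[p₁] = p, σ₁[p₂] = m, σ₂[p₃] = m, and σ₂[p₄] = q. -/

import Mathlib

inductive Pattern (K X : Type) : Type
  | var : X → Pattern K X
  | con : K → List (Pattern K X) → Pattern K X

abbrev Subst (K X : Type) : Type := X → Pattern K X

def Pattern.subst {K X : Type} (σ : Subst K X) : Pattern K X → Pattern K X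
  | .var x => σ x
  | .con k ps => .con k (ps.attach.map fun q => Pattern.subst σ q.1)
termination_by p => sizeOf p
decreasing_by
  have := List.sizeOf_lt_of_mem q.2
  simp only [Pattern.con.sizeOf_spec]
  omega

def scomp {K X : Type} (σ₁ σ₂ : Subst K X) : Subst K X :=
  fun x => (σ₂ x).subst σ₁

def Factors {K X : Type} (σ₁ σ₂ : Subst K X) : Prop :=
  ∃ σ₃, σ₁ = scomp σ₃ σ₂

def Unifies {K X : Type} (σ₁ σ₂ : Subst K X) (p₁ p₂ : Pattern K X) : Prop :=
  p₁.subst σ₁ = p₂.subst σ₂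

def IsMGU {K X : Type} (σ₁ σ₂ : Subst K X) (p₁ p₂ : Pattern K X) : Prop :=
  Unifies σ₁ σ₂ p₁ p₂ ∧
  ∀ σ₁' σ₂' : Subst K X, Unifies σ₁' σ₂' p₁ p₂ → Factors σ₁' σ₁ ∧ Factors σ₂' σ₂

inductive IsGround {K X : Type} : Pattern K X → Prop
  | con (k : K) (ps : List (Pattern K X)) : (∀ p ∈ ps, IsGround p) → IsGround (.con k ps)

inductive VarOccurs {K X : Type} (x : X) : Pattern K X → Prop
  | var : VarOccurs x (.var x)
  | con (k : K) (ps : List (Pattern K X)) (p : Pattern K X) :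
      p ∈ ps → VarOccurs x p → VarOccurs x (.con k ps)

abbrev Rule (K X : Type) : Type := Pattern K X × Pattern K X

def Functional {K X : Type} (r : Rule K X) : Prop :=
  ∀ x, VarOccurs x r.2 → VarOccurs x r.1

def Step {K X : Type} (r : Rule K X) (t₁ t₂ : Pattern K X) : Prop :=
  ∃ σ : Subst K X, r.1.subst σ = t₁ ∧ r.2.subst σ = t₂

def ComposedBy {K X : Type} (r₁ r₂ r : Rule K X) : Prop :=
  ∃ σ₁ σ₂ : Subst K X, IsMGU σ₁ σ₂ r₁.2 r₂.1 ∧ r = (r₁.1.subst σ₁, r₂.2.subst σ₂)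

def RuleEquiv {K X : Type} (r r' : Rule K X) : Prop :=
  ∃ σ₁ σ₂ : Subst K X,
    r.1.subst σ₁ = r'.1 ∧ r.2.subst σ₁ = r'.2 ∧
    r'.1.subst σ₂ = r.1 ∧ r'.2.subst σ₂ = r.2

def StepSet {K X : Type} (R : Set (Rule K X)) (t₁ t₂ : Pattern K X) : Prop :=
  ∃ r ∈ R, Step r t₁ t₂

def Evaluates {K X : Type} (R : Set (Rule K X)) (t₁ t₂ : Pattern K X) : Prop :=
  Relation.ReflTransGen (StepSet R) t₁ t₂ ∧ ∀ t₃, ¬ StepSet R t₂ t₃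

theorem Pattern.subst_var {K X : Type} (σ : Subst K X) (x : X) :
    (Pattern.var x : Pattern K X).subst σ = σ x := by
  rw [Pattern.subst]

theorem Pattern.subst_con {K X : Type} (σ : Subst K X) (k : K) (ps : List (Pattern K X)) :
    (Pattern.con k ps).subst σ = .con k (ps.map (Pattern.subst σ)) := by
  rw [Pattern.subst, List.attach_map_val]

theorem Pattern.induction_on_mem {K X : Type} {P : Pattern K X → Prop}
    (var : ∀ x, P (.var x)) (con : ∀ k ps, (∀ p ∈ ps, P p) → P (.con k ps)) :
    ∀ p, P p
  | .var x => var x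
  | .con k ps => con k ps fun p _ => induction_on_mem var con p
termination_by p => sizeOf p
decreasing_by
  have := List.sizeOf_lt_of_mem ‹p ∈ ps›
  simp only [Pattern.con.sizeOf_spec]
  omega

theorem Pattern.subst_scomp {K X : Type} (σ₁ σ₂ : Subst K X) (p : Pattern K X) :
    p.subst (scomp σ₁ σ₂) = (p.subst σ₂).subst σ₁ := by
  induction p using Pattern.induction_on_mem with
  | var x => simp only [subst_var, scomp]
  | con k ps ih =>
    simpa only [subst_con, List.map_map, Pattern.con.injEq, true_and, List.map_inj_left,
      Function.comp_apply] using ih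

/-- Two substitutions act equally on a pattern iff they agree on its variables. -/
theorem Pattern.subst_eq_subst_iff {K X : Type} {σ τ : Subst K X} {p : Pattern K X} :
    p.subst σ = p.subst τ ↔ ∀ x, VarOccurs x p → σ x = τ x := by
  induction p using Pattern.induction_on_mem with
  | var y =>
    simp only [subst_var]
    exact ⟨fun h x hx => by cases hx; exact h, fun h => h y .var⟩
  | con k ps ih =>
    simp only [subst_con, Pattern.con.injEq, true_and, List.map_inj_left]
    constructor
    · rintro h x (_ | ⟨_, _, p, hp, hx⟩)
      exact (ih p hp).1 (h p hp) x hx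
    · exact fun h p hp => (ih p hp).2 fun x hx => h x (.con k ps p hp hx)

theorem composition_is_relational_composition {K X : Type} [Countable X] [Infinite X]
    (p₁ p₂ p₃ p₄ l s : Pattern K X)
    (hf₁ : Functional (p₁, p₂)) (hf₂ : Functional (p₃, p₄))
    (hc : ComposedBy (p₁, p₂) (p₃, p₄) (l, s)) :
    ∀ p q : Pattern K X,
      (∃ σ : Subst K X, l.subst σ = p ∧ s.subst σ = q) ↔
      (∃ (m : Pattern K X) (σ₁ σ₂ : Subst K X),
        p₁.subst σ₁ = p ∧ p₂.subst σ₁ = m ∧ p₃.subst σ₂ = m ∧ p₄.subst σ₂ = q) := by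
  obtain ⟨σ₁, σ₂, ⟨hu, hmgu⟩, hr⟩ := hc
  obtain ⟨rfl, rfl⟩ := Prod.mk.inj hr
  unfold Unifies at hu hmgu
  dsimp only at hu hmgu ⊢
  intro p q
  constructor
  · rintro ⟨σ, rfl, rfl⟩
    refine ⟨_, scomp σ σ₁, scomp σ σ₂, Pattern.subst_scomp .., rfl, ?_, Pattern.subst_scomp ..⟩
    rw [Pattern.subst_scomp, Pattern.subst_scomp, hu]
  · rintro ⟨m, τ₁, τ₂, rfl, rfl, hm, rfl⟩
    obtain ⟨⟨ρ₁, rfl⟩, ρ₂, rfl⟩ := hmgu τ₁ τ₂ hm.symm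
    refine ⟨ρ₁, (Pattern.subst_scomp ..).symm, ?_⟩
    have h : p₃.subst (scomp ρ₁ σ₂) = p₃.subst (scomp ρ₂ σ₂) := by
      rw [hm, Pattern.subst_scomp, Pattern.subst_scomp, hu]
    rw [← Pattern.subst_scomp]
    exact Pattern.subst_eq_subst_iff.2 fun x hx =>
      Pattern.subst_eq_subst_iff.1 h x (hf₂ x hx)
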